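/- Let d = Σ_j d_j α_j be an element of the root lattice of a finite root system with no factors of type E_8, where all d_j are integers, let (·,·) be the W-invariant form normalized so short roots have squared length 2, and let r(d) = #{j : d_j ≠ 0}. Then for every simple root index i, (d,d)/2 + r(d) ≥ d_i, with equality if and only if d = 0. -/

import Mathlib

/-- Irreducible Dynkin types other than `E₈`. -/
inductive NonE8Type
  | A : ℕ → NonE8Type  -- rank n+1
  | B : ℕ → NonE8Type  -- rank n+2
  | C : ℕ → NonE8Type  -- rank n+3
  | D : ℕ → NonE8Type  -- rank n+4
  | E6 | E7 | F4 | G2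

namespace NonE8Type

def rank : NonE8Type → ℕ
  | A n => n + 1
  | B n => n + 2
  | C n => n + 3
  | D n => n + 4
  | E6 => 6
  | E7 => 7
  | F4 => 4
  | G2 => 2

/-- The matrix `(α_a, α_b)` of the `W`-invariant form, normalized so that short roots have
squared length `2` (this is `2A_R` in the notation of the paper). -/
def gram : (t : NonE8Type) → Matrix (Fin t.rank) (Fin t.rank) ℝ
  | A _ => fun a b =>
      if a = b then 2 else if a.val + 1 = b.val ∨ b.val + 1 = a.val then -1 else 0
  | B n => fun a b =>  -- last simple root short
      if a = b then (if a.val = n + 1 then 2 else 4)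
      else if a.val + 1 = b.val ∨ b.val + 1 = a.val then -2 else 0
  | C n => fun a b =>  -- last simple root long
      if a = b then (if a.val = n + 2 then 4 else 2)
      else if a.val + 1 = b.val ∨ b.val + 1 = a.val then
        (if a.val = n + 2 ∨ b.val = n + 2 then -2 else -1)
      else 0
  | D n => fun a b =>
      if a = b then 2
      else if (a.val + 1 = b.val ∧ b.val ≤ n + 2) ∨ (b.val + 1 = a.val ∧ a.val ≤ n + 2) ∨
          (a.val = n + 1 ∧ b.val = n + 3) ∨ (b.val = n + 1 ∧ a.val = n + 3) then -1
      else 0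
  | E6 => fun a b =>
      if a = b then 2
      else if (a.val, b.val) ∈ [(0, 2), (2, 3), (3, 4), (4, 5), (1, 3)] ∨
          (b.val, a.val) ∈ [(0, 2), (2, 3), (3, 4), (4, 5), (1, 3)] then -1
      else 0
  | E7 => fun a b =>
      if a = b then 2
      else if (a.val, b.val) ∈ [(0, 2), (2, 3), (3, 4), (4, 5), (5, 6), (1, 3)] ∨
          (b.val, a.val) ∈ [(0, 2), (2, 3), (3, 4), (4, 5), (5, 6), (1, 3)] then -1
      else 0
  | F4 => !![4, -2, 0, 0; -2, 4, -2, 0; 0, -2, 2, -1; 0, 0, -1, 2]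
  | G2 => !![2, -3; -3, 6]

end NonE8Type

/-- Summing against the neighbour indicator of a new last node of a path picks out the previous
node. -/
lemma sum_mul_ite_last (f : ℕ → ℝ) (h0 : f 0 = 0) (c : ℝ) (N : ℕ) :
    ∑ a : Fin N, f (a + 1) * (if a.val + 1 = N then c else 0) = f N * c := by
  cases N with
  | zero => simp [h0]
  | succ N =>
    rw [Fin.sum_univ_castSucc, Finset.sum_eq_zero]
    · simp
    · intro a _
      have := a.2
      simp [this.ne]

/-- The quadratic form of a path, as a sum of squares of increments. -/
lemma path_form_eq (f : ℕ → ℝ) (h0 : f 0 = 0) (N : ℕ) :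
    ∑ a : Fin N, ∑ b : Fin N, f (a + 1) * f (b + 1) *
        (if a = b then 2 else if a.val + 1 = b.val ∨ b.val + 1 = a.val then -1 else 0) =
      ∑ j ∈ Finset.range N, (f (j + 1) - f j) ^ 2 + f N ^ 2 := by
  induction N with
  | zero => simp [h0]
  | succ N ih =>
    have cross := sum_mul_ite_last f h0 (-f (N + 1)) N
    have h1 : ∀ a : Fin N, ¬ (N + 1 = a.val) := fun a => by omega
    have h2 : ∀ a : Fin N, ¬ (N = a.val) := fun a => by omega
    have h3 : ∀ a : Fin N, ¬ (a.val = N) := fun a => by omega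
    have left : ∑ a : Fin N, f (a + 1) * f (N + 1) * (if a.val + 1 = N then (-1 : ℝ) else 0) =
        f N * -f (N + 1) := by
      rw [← cross]; refine Finset.sum_congr rfl fun a _ => ?_; split_ifs <;> ring
    have right : ∑ a : Fin N, f (N + 1) * f (a + 1) * (if a.val + 1 = N then (-1 : ℝ) else 0) =
        f N * -f (N + 1) := by
      rw [← cross]; refine Finset.sum_congr rfl fun a _ => ?_; split_ifs <;> ring
    simp only [Fin.sum_univ_castSucc, Finset.sum_add_distrib, Finset.sum_range_succ, Fin.ext_iff,
      Fin.val_castSucc, Fin.val_last, h1, h2, h3, or_false, false_or, if_false, if_true] at ih ⊢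
    rw [ih, left, right]
    ring

/-- The quadratic form of a path with scaled form `s`, bordered by one more node attached to its
end. -/
lemma bordered_path_form_eq (f : ℕ → ℝ) (h0 : f 0 = 0) (N : ℕ) (y s c p : ℝ)
    (g : Fin (N + 1) → ℝ) (hg : ∀ a : Fin N, g a.castSucc = f (a + 1)) (hy : g (Fin.last N) = y)
    (G : Fin (N + 1) → Fin (N + 1) → ℝ)
    (hG : ∀ a b : Fin N, G a.castSucc b.castSucc =
      s * (if a = b then 2 else if a.val + 1 = b.val ∨ b.val + 1 = a.val then -1 else 0))
    (hr : ∀ a : Fin N, G a.castSucc (Fin.last N) = if a.val + 1 = N then c else 0)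
    (hl : ∀ a : Fin N, G (Fin.last N) a.castSucc = if a.val + 1 = N then c else 0)
    (hp : G (Fin.last N) (Fin.last N) = p) :
    ∑ a, ∑ b, g a * g b * G a b =
      s * (∑ j ∈ Finset.range N, (f (j + 1) - f j) ^ 2 + f N ^ 2) + 2 * c * f N * y
        + p * y ^ 2 := by
  have cross := sum_mul_ite_last f h0 c N
  simp only [Fin.sum_univ_castSucc, Finset.sum_add_distrib, hg, hy, hG, hr, hl, hp]
  have left : ∑ a : Fin N, f (a + 1) * y * (if a.val + 1 = N then c else 0) = y * (f N * c) := by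
    rw [← cross, Finset.mul_sum]; exact Finset.sum_congr rfl fun a _ => by ring
  have right : ∑ a : Fin N, y * f (a + 1) * (if a.val + 1 = N then c else 0) = y * (f N * c) := by
    rw [← cross, Finset.mul_sum]; exact Finset.sum_congr rfl fun a _ => by ring
  rw [left, right, ← path_form_eq f h0 N, Finset.mul_sum]
  simp only [Finset.mul_sum]
  rw [Finset.sum_congr rfl fun a _ => Finset.sum_congr rfl fun b _ => mul_left_comm _ s _]
  ring

lemma Int.abs_le_sq_self (z : ℤ) : |z| ≤ z ^ 2 := by
  simpa using Int.le_self_sq |z|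

/-- An integer sequence starting at `0` is bounded by the sum of its squared increments. -/
lemma abs_le_sum_sq_diff (f : ℕ → ℤ) (h0 : f 0 = 0) (k : ℕ) :
    |f k| ≤ ∑ j ∈ Finset.range k, (f (j + 1) - f j) ^ 2 := by
  induction k with
  | zero => simp [h0]
  | succ k ih =>
    rw [Finset.sum_range_succ]
    have h1 := Int.abs_le_sq_self (f (k + 1) - f k)
    have h2 := abs_sub_abs_le_abs_sub (f (k + 1)) (f k)
    linarith

lemma two_mul_le_sum_sq_diff_add (f : ℕ → ℤ) (h0 : f 0 = 0) {k N : ℕ} (hk : k ≤ N) :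
    2 * f k ≤ ∑ j ∈ Finset.range N, (f (j + 1) - f j) ^ 2 + f N ^ 2 := by
  suffices h : 2 * f k ≤ ∑ j ∈ Finset.range N, (f (j + 1) - f j) ^ 2 + |f N| by
    linarith [Int.abs_le_sq_self (f N)]
  induction N, hk using Nat.le_induction with
  | base => linarith [abs_le_sum_sq_diff f h0 k, le_abs_self (f k)]
  | succ N _ ih =>
    rw [Finset.sum_range_succ]
    have h1 := Int.abs_le_sq_self (f (N + 1) - f N)
    have h2 := abs_sub_abs_le_abs_sub (f N) (f (N + 1))
    rw [abs_sub_comm] at h2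
    linarith

lemma two_mul_add_le_sum_sq_diff_add_support (f : ℕ → ℤ) (h0 : f 0 = 0) (k : ℕ) :
    2 * f k + (if f k ≠ 0 then 1 else 0) ≤
      ∑ j ∈ Finset.range k, (f (j + 1) - f j) ^ 2 +
        2 * ∑ j ∈ Finset.range k, (if f (j + 1) ≠ 0 then 1 else 0) := by
  induction k with
  | zero => simp [h0]
  | succ k ih =>
    rw [Finset.sum_range_succ, Finset.sum_range_succ]
    have := sq_nonneg (f (k + 1) - f k - 1)
    split_ifs at ih ⊢ <;> simp_all <;> nlinarith

lemma sum_sq_diff_mono (f : ℕ → ℤ) {k N : ℕ} (hk : k ≤ N) :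
    ∑ j ∈ Finset.range k, (f (j + 1) - f j) ^ 2 ≤
      ∑ j ∈ Finset.range N, (f (j + 1) - f j) ^ 2 :=
  Finset.sum_le_sum_of_subset_of_nonneg (by simpa using hk) fun _ _ _ => sq_nonneg _

lemma Int.lt_add_of_sq_le {x q r M : ℤ} (hM : 0 < M) (hr : M < 4 * r) (h : x ^ 2 ≤ M * q) :
    x < q + r := by
  by_contra! hx
  nlinarith [sq_nonneg (2 * x - M)]

/-- The inequality for `E₇`, for the half-form and the support size in coordinates. -/
lemma e7_bound (x₀ x₁ x₂ x₃ x₄ x₅ x₆ r : ℤ)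
    (hr : r = (if x₀ ≠ 0 then 1 else 0) + (if x₁ ≠ 0 then 1 else 0) + (if x₂ ≠ 0 then 1 else 0) +
      (if x₃ ≠ 0 then 1 else 0) + (if x₄ ≠ 0 then 1 else 0) + (if x₅ ≠ 0 then 1 else 0) +
      (if x₆ ≠ 0 then 1 else 0)) (q : ℤ)
    (hq : q = x₀ ^ 2 + x₁ ^ 2 + x₂ ^ 2 + x₃ ^ 2 + x₄ ^ 2 + x₅ ^ 2 + x₆ ^ 2 - x₀ * x₂ - x₂ * x₃ -
      x₃ * x₄ - x₄ * x₅ - x₅ * x₆ - x₁ * x₃) :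
    0 ≤ q ∧ (0 < r →
      x₀ < q + r ∧ x₁ < q + r ∧ x₂ < q + r ∧ x₃ < q + r ∧ x₄ < q + r ∧ x₅ < q + r ∧ x₆ < q + r) := by
  refine ⟨?_, fun hr0 => ?_⟩
  · clear hr
    linarith [sq_nonneg (2 * x₀ - x₂), sq_nonneg (3 * x₂ - 2 * x₃), sq_nonneg (2 * x₆ - x₅),
      sq_nonneg (3 * x₅ - 2 * x₄), sq_nonneg (4 * x₄ - 3 * x₃), sq_nonneg (2 * x₁ - x₃),
      sq_nonneg x₃]
  have key : ∀ z : ℤ, z ≤ z ^ 2 ∧ -z ≤ z ^ 2 := fun z =>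
    ⟨Int.le_self_sq z, by simpa using Int.le_self_sq (-z)⟩
  by_cases hb : x₁ = 0 ∨ x₂ = 0 ∨ x₃ = 0 ∨ x₄ = 0
  · have k₀ := key x₀
    have k₁ := key x₁
    have k₂ := key x₂
    have k₃ := key x₃
    have k₄ := key x₄
    have k₅ := key x₅
    have k₆ := key x₆
    have k₀₂ := key (x₀ - x₂)
    have k₂₃ := key (x₂ - x₃)
    have k₃₄ := key (x₃ - x₄)
    have k₄₅ := key (x₄ - x₅)
    have k₅₆ := key (x₅ - x₆)
    have k₁₃ := key (x₁ - x₃)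
    clear hr key
    rcases hb with rfl | rfl | rfl | rfl <;> refine ⟨?_, ?_, ?_, ?_, ?_, ?_, ?_⟩ <;> linarith
  · push Not at hb
    obtain ⟨h₁, h₂, h₃, h₄⟩ := hb
    have hr4 : 4 ≤ r := by
      simp only [ne_eq, h₁, h₂, h₃, h₄, not_false_eq_true, if_true] at hr
      split_ifs at hr <;> omega
    have sq_bound : ∀ x, x ^ 2 ≤ 15 * q → x < q + r := fun x hx =>
      Int.lt_add_of_sq_le (by norm_num) (by omega) hx
    refine ⟨?_, ?_, ?_, ?_, ?_, ?_, ?_⟩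
    · apply sq_bound
      linarith [sq_nonneg (2 * x₆ - x₅), sq_nonneg (3 * x₅ - 2 * x₄), sq_nonneg (4 * x₄ - 3 * x₃),
        sq_nonneg (2 * x₁ - x₃), sq_nonneg (3 * x₃ - 4 * x₂), sq_nonneg (2 * x₂ - 3 * x₀),
        sq_nonneg x₀]
    · apply sq_bound
      linarith [sq_nonneg (2 * x₀ - x₂), sq_nonneg (3 * x₂ - 2 * x₃), sq_nonneg (2 * x₆ - x₅),
        sq_nonneg (3 * x₅ - 2 * x₄), sq_nonneg (4 * x₄ - 3 * x₃), sq_nonneg (7 * x₃ - 12 * x₁),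
        sq_nonneg x₁]
    · apply sq_bound
      linarith [sq_nonneg (2 * x₀ - x₂), sq_nonneg (2 * x₆ - x₅), sq_nonneg (3 * x₅ - 2 * x₄),
        sq_nonneg (4 * x₄ - 3 * x₃), sq_nonneg (2 * x₁ - x₃), sq_nonneg (3 * x₃ - 4 * x₂),
        sq_nonneg x₂]
    · by_cases h : x₀ ≠ 0 ∧ x₅ ≠ 0 ∧ x₆ ≠ 0
      · have : r = 7 := by simp [*]
        refine Int.lt_add_of_sq_le (M := 24) (by norm_num) (by omega) ?_
        linarith [sq_nonneg (2 * x₀ - x₂), sq_nonneg (3 * x₂ - 2 * x₃), sq_nonneg (2 * x₆ - x₅),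
          sq_nonneg (3 * x₅ - 2 * x₄), sq_nonneg (4 * x₄ - 3 * x₃), sq_nonneg (2 * x₁ - x₃),
          sq_nonneg x₃]
      · apply sq_bound
        clear hr
        have : x₀ = 0 ∨ x₅ = 0 ∨ x₆ = 0 := by tauto
        rcases this with rfl | rfl | rfl
        · linarith [sq_nonneg (2 * x₁ - x₃), sq_nonneg (2 * x₂ - x₃), sq_nonneg (4 * x₄ - 3 * x₃),
            sq_nonneg (3 * x₅ - 2 * x₄), sq_nonneg (2 * x₆ - x₅), sq_nonneg x₃]
        · linarith [sq_nonneg (2 * x₁ - x₃), sq_nonneg (2 * x₀ - x₂), sq_nonneg (3 * x₂ - 2 * x₃),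
            sq_nonneg (2 * x₄ - x₃), sq_nonneg x₆, sq_nonneg x₃]
        · linarith [sq_nonneg (2 * x₁ - x₃), sq_nonneg (2 * x₀ - x₂), sq_nonneg (3 * x₂ - 2 * x₃),
            sq_nonneg (3 * x₄ - 2 * x₃), sq_nonneg (2 * x₅ - x₄), sq_nonneg x₃]
    · apply sq_bound
      linarith [sq_nonneg (2 * x₀ - x₂), sq_nonneg (3 * x₂ - 2 * x₃), sq_nonneg (2 * x₁ - x₃),
        sq_nonneg (5 * x₃ - 6 * x₄), sq_nonneg (2 * x₆ - x₅), sq_nonneg (3 * x₅ - 2 * x₄),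
        sq_nonneg x₄]
    · apply sq_bound
      linarith [sq_nonneg (2 * x₀ - x₂), sq_nonneg (3 * x₂ - 2 * x₃), sq_nonneg (2 * x₁ - x₃),
        sq_nonneg (5 * x₃ - 6 * x₄), sq_nonneg (4 * x₄ - 5 * x₅), sq_nonneg (2 * x₆ - x₅),
        sq_nonneg x₅]
    · apply sq_bound
      linarith [sq_nonneg (2 * x₀ - x₂), sq_nonneg (3 * x₂ - 2 * x₃), sq_nonneg (2 * x₁ - x₃),
        sq_nonneg (5 * x₃ - 6 * x₄), sq_nonneg (4 * x₄ - 5 * x₅), sq_nonneg (3 * x₅ - 4 * x₆),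
        sq_nonneg x₆]


/-- The inequality for `F₄`, for the half-form and the support size in coordinates. -/
lemma f4_bound (x₀ x₁ x₂ x₃ r : ℤ)
    (hr : r = (if x₀ ≠ 0 then 1 else 0) + (if x₁ ≠ 0 then 1 else 0) + (if x₂ ≠ 0 then 1 else 0) +
      (if x₃ ≠ 0 then 1 else 0)) (q : ℤ)
    (hq : q = 2 * x₀ ^ 2 + 2 * x₁ ^ 2 + x₂ ^ 2 + x₃ ^ 2 - 2 * x₀ * x₁ - 2 * x₁ * x₂ - x₂ * x₃) :
    0 ≤ q ∧ (0 < r → x₀ < q + r ∧ x₁ < q + r ∧ x₂ < q + r ∧ x₃ < q + r) := by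
  refine ⟨?_, fun hr0 => ?_⟩
  · clear hr
    linarith [sq_nonneg (2 * x₀ - x₁), sq_nonneg (3 * x₁ - 2 * x₂), sq_nonneg (2 * x₃ - x₂),
      sq_nonneg x₂]
  by_cases hb : x₁ = 0 ∨ x₂ = 0
  · have sq_bound : ∀ x, x ^ 2 ≤ 3 * q → x < q + r := fun x hx =>
      Int.lt_add_of_sq_le (by norm_num) (by omega) hx
    clear hr
    rcases hb with rfl | rfl <;> refine ⟨?_, ?_, ?_, ?_⟩ <;> apply sq_bound
    iterate 4
      linarith [sq_nonneg x₀, sq_nonneg x₂, sq_nonneg x₃, sq_nonneg (2 * x₂ - x₃),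
        sq_nonneg (2 * x₃ - x₂)]
    iterate 4
      linarith [sq_nonneg x₀, sq_nonneg x₁, sq_nonneg x₃, sq_nonneg (2 * x₀ - x₁),
        sq_nonneg (2 * x₁ - x₀)]
  · push Not at hb
    obtain ⟨h₁, h₂⟩ := hb
    have hr2 : 2 ≤ r := by
      simp only [ne_eq, h₁, h₂, not_false_eq_true, if_true] at hr
      split_ifs at hr <;> omega
    have sq_bound : ∀ x, x ^ 2 ≤ 6 * q → x < q + r := fun x hx =>
      Int.lt_add_of_sq_le (by norm_num) (by omega) hx
    refine ⟨?_, ?_, ?_, ?_⟩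
    · apply sq_bound
      linarith [sq_nonneg (2 * x₃ - x₂), sq_nonneg (3 * x₂ - 4 * x₁), sq_nonneg (2 * x₁ - 3 * x₀),
        sq_nonneg x₀]
    · apply sq_bound
      linarith [sq_nonneg (2 * x₀ - x₁), sq_nonneg (2 * x₃ - x₂), sq_nonneg (3 * x₂ - 4 * x₁),
        sq_nonneg x₁]
    · by_cases h : x₀ ≠ 0 ∧ x₃ ≠ 0
      · have : r = 4 := by simp [*]
        refine Int.lt_add_of_sq_le (M := 12) (by norm_num) (by omega) ?_
        linarith [sq_nonneg (2 * x₀ - x₁), sq_nonneg (3 * x₁ - 2 * x₂), sq_nonneg (2 * x₃ - x₂),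
          sq_nonneg x₂]
      · apply sq_bound
        clear hr
        have : x₀ = 0 ∨ x₃ = 0 := by tauto
        rcases this with rfl | rfl
        · linarith [sq_nonneg (2 * x₁ - x₂), sq_nonneg (2 * x₃ - x₂), sq_nonneg x₂]
        · linarith [sq_nonneg (2 * x₀ - x₁), sq_nonneg (3 * x₁ - 2 * x₂), sq_nonneg x₂]
    · apply sq_bound
      linarith [sq_nonneg (2 * x₀ - x₁), sq_nonneg (3 * x₁ - 2 * x₂), sq_nonneg (2 * x₂ - 3 * x₃),
        sq_nonneg x₃]

/-- The inequality for `G₂`, for the half-form and the support size in coordinates. -/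
lemma g2_bound (x₀ x₁ r : ℤ)
    (hr : r = (if x₀ ≠ 0 then 1 else 0) + (if x₁ ≠ 0 then 1 else 0)) (q : ℤ)
    (hq : q = x₀ ^ 2 + 3 * x₁ ^ 2 - 3 * x₀ * x₁) :
    0 ≤ q ∧ (0 < r → x₀ < q + r ∧ x₁ < q + r) := by
  refine ⟨by linarith [sq_nonneg (2 * x₀ - 3 * x₁), sq_nonneg x₁], fun hr0 => ?_⟩
  by_cases hb : x₀ = 0 ∨ x₁ = 0
  · have sq_bound : ∀ x, x ^ 2 ≤ q → x < q + r := fun x hx =>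
      Int.lt_add_of_sq_le one_pos (by omega) (by linarith)
    clear hr
    rcases hb with rfl | rfl
    · exact ⟨sq_bound _ (by linarith [sq_nonneg x₁]), sq_bound _ (by linarith [sq_nonneg x₁])⟩
    · exact ⟨sq_bound _ (by linarith), sq_bound _ (by linarith [sq_nonneg x₀])⟩
  · push Not at hb
    have : r = 2 := by simp [*]
    have sq_bound : ∀ x, x ^ 2 ≤ 4 * q → x < q + r := fun x hx =>
      Int.lt_add_of_sq_le (by norm_num) (by omega) hx
    refine ⟨?_, ?_⟩ <;> apply sq_bound
    · linarith [sq_nonneg (x₀ - 2 * x₁)]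
    · linarith [sq_nonneg (2 * x₀ - 3 * x₁), sq_nonneg x₁]

/-- The form of `G` is nonnegative on integer vectors, and half of it plus the size of the support
exceeds every coordinate of a nonzero vector. -/
def Matrix.SupportBound {n : ℕ} (G : Matrix (Fin n) (Fin n) ℝ) : Prop :=
  ∀ d : Fin n → ℤ, 0 ≤ ∑ a, ∑ b, (d a : ℝ) * (d b : ℝ) * G a b ∧
    ∀ i, d i ≠ 0 → (d i : ℝ) < (∑ a, ∑ b, (d a : ℝ) * (d b : ℝ) * G a b) / 2 +
      ((Finset.univ.filter fun a => d a ≠ 0).card : ℝ)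

lemma exists_shifted_extension {N : ℕ} (d : Fin N → ℤ) :
    ∃ f : ℕ → ℤ, f 0 = 0 ∧ ∀ a : Fin N, d a = f (a + 1) :=
  ⟨fun j => if h : 0 < j ∧ j ≤ N then d ⟨j - 1, by omega⟩ else 0, by simp, fun a => by simp⟩

/-- It suffices to bound the form of an integer vector by an integer quantity. -/
lemma Matrix.SupportBound.of_int {n : ℕ} {G : Matrix (Fin n) (Fin n) ℝ}
    (h : ∀ d : Fin n → ℤ, ∃ q : ℤ, ∑ a, ∑ b, (d a : ℝ) * (d b : ℝ) * G a b = q ∧ 0 ≤ q ∧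
      (0 < (Finset.univ.filter fun a => d a ≠ 0).card → ∀ i, d i ≠ 0 →
        2 * d i < q + 2 * ((Finset.univ.filter fun a => d a ≠ 0).card : ℤ))) :
    G.SupportBound := by
  intro d
  obtain ⟨q, hq, hq0, hlt⟩ := h d
  rw [hq]
  refine ⟨by exact_mod_cast hq0, fun i hi => ?_⟩
  have := hlt (Finset.card_pos.mpr ⟨i, by simpa using hi⟩) i hi
  have : (2 * d i : ℝ) < q + 2 * ((Finset.univ.filter fun a => d a ≠ 0).card : ℝ) := by
    exact_mod_cast this
  linarith

lemma sum_support_le_card {n : ℕ} (d : Fin n → ℤ) (f : ℕ → ℤ) {k : ℕ} (hk : k ≤ n)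
    (hd : ∀ a : Fin k, d (Fin.castLE hk a) = f (a + 1)) :
    ∑ j ∈ Finset.range k, (if f (j + 1) ≠ 0 then (1 : ℤ) else 0) ≤
      ((Finset.univ.filter fun a => d a ≠ 0).card : ℤ) := by
  rw [← Fin.sum_univ_eq_sum_range (fun j => if f (j + 1) ≠ 0 then (1 : ℤ) else 0),
    Finset.sum_boole]
  refine Nat.cast_le.mpr (Finset.card_le_card_of_injOn (Fin.castLE hk) ?_
    (Fin.castLE_injective hk).injOn)
  intro a ha
  simpa [hd] using ha

namespace NonE8Type

lemma gram_B_apply (n : ℕ) (a b : Fin (n + 2)) : (B n).gram a b =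
    if a = b then (if a.val = n + 1 then 2 else 4)
    else if a.val + 1 = b.val ∨ b.val + 1 = a.val then -2 else 0 := rfl

lemma gram_C_apply (n : ℕ) (a b : Fin (n + 3)) : (C n).gram a b =
    if a = b then (if a.val = n + 2 then 4 else 2)
    else if a.val + 1 = b.val ∨ b.val + 1 = a.val then
      (if a.val = n + 2 ∨ b.val = n + 2 then -2 else -1)
    else 0 := rfl

lemma gram_D_apply (n : ℕ) (a b : Fin (n + 4)) : (D n).gram a b =
    if a = b then 2
    else if (a.val + 1 = b.val ∧ b.val ≤ n + 2) ∨ (b.val + 1 = a.val ∧ a.val ≤ n + 2) ∨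
        (a.val = n + 1 ∧ b.val = n + 3) ∨ (b.val = n + 1 ∧ a.val = n + 3) then -1
    else 0 := rfl

lemma supportBound_A (n : ℕ) : (A n).gram.SupportBound := by
  refine .of_int fun (d : Fin (n + 1) → ℤ) => ?_
  obtain ⟨f, h0, hd⟩ := exists_shifted_extension d
  refine ⟨∑ j ∈ Finset.range (n + 1), (f (j + 1) - f j) ^ 2 + f (n + 1) ^ 2, ?_, by positivity, ?_⟩
  · change ∑ a : Fin (n + 1), ∑ b : Fin (n + 1), (d a : ℝ) * d b * (if a = b then 2 else
      if a.val + 1 = b.val ∨ b.val + 1 = a.val then -1 else 0) = _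
    simp only [hd]
    push_cast
    exact path_form_eq (fun j => (f j : ℝ)) (by simp [h0]) (n + 1)
  · rintro hr (i : Fin (n + 1)) -
    have := two_mul_le_sum_sq_diff_add f h0 (Nat.succ_le_of_lt i.2)
    rw [hd]
    lia

lemma supportBound_B (n : ℕ) : (B n).gram.SupportBound := by
  refine .of_int fun (d : Fin (n + 2) → ℤ) => ?_
  obtain ⟨f, h0, hd⟩ := exists_shifted_extension d
  refine ⟨2 * ∑ j ∈ Finset.range (n + 2), (f (j + 1) - f j) ^ 2, ?_, by positivity, ?_⟩
  · refine (bordered_path_form_eq (fun j => (f j : ℝ)) (by simp [h0]) (n + 1) (f (n + 2)) 2 (-2) 2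
      (fun a => (d a : ℝ)) (by simp [hd]) (by simp [hd]) (B n).gram ?_ ?_ ?_ ?_).trans ?_
    · intro a b
      have := a.2.ne
      simp only [gram_B_apply, Fin.ext_iff, Fin.val_castSucc, this, if_false]
      split_ifs <;> norm_num
    · intro a
      have := a.2.ne
      have h' : ¬ (n + 1 + 1 = a.val) := by omega
      simp [gram_B_apply, Fin.ext_iff, this, h']
    · intro a
      have := a.2.ne'
      have h' : ¬ (n + 1 + 1 = a.val) := by omega
      simp [gram_B_apply, Fin.ext_iff, this, h']
    · simp [gram_B_apply]
    · rw [Finset.sum_range_succ _ (n + 1)]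
      push_cast
      ring
  · rintro hr (i : Fin (n + 2)) -
    have h1 := abs_le_sum_sq_diff f h0 (i + 1)
    have h2 := sum_sq_diff_mono f (Nat.succ_le_of_lt i.2)
    have h3 := le_abs_self (f (i + 1))
    rw [hd]
    lia

lemma supportBound_C (n : ℕ) : (C n).gram.SupportBound := by
  refine .of_int fun (d : Fin (n + 3) → ℤ) => ?_
  obtain ⟨f, h0, hd⟩ := exists_shifted_extension d
  refine ⟨∑ j ∈ Finset.range (n + 2), (f (j + 1) - f j) ^ 2 + (f (n + 2) - 2 * f (n + 3)) ^ 2, ?_,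
    by positivity, ?_⟩
  · refine (bordered_path_form_eq (fun j => (f j : ℝ)) (by simp [h0]) (n + 2) (f (n + 3)) 1 (-2) 4
      (fun a => (d a : ℝ)) (by simp [hd]) (by simp [hd]) (C n).gram ?_ ?_ ?_ ?_).trans ?_
    · intro a b
      have := a.2.ne
      have := b.2.ne
      simp [gram_C_apply, Fin.ext_iff, *]
    · intro a
      have := a.2.ne
      have h' : ¬ (n + 2 + 1 = a.val) := by omega
      simp [gram_C_apply, Fin.ext_iff, this, h']
    · intro a
      have := a.2.ne'
      have h' : ¬ (n + 2 + 1 = a.val) := by omega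
      simp [gram_C_apply, Fin.ext_iff, this, h']
    · simp [gram_C_apply]
    · push_cast
      ring
  · rintro hr (i : Fin (n + 3)) hi
    rw [hd] at hi ⊢
    obtain h | h := Nat.lt_or_ge i (n + 2)
    · have h1 := two_mul_add_le_sum_sq_diff_add_support f h0 (i + 1)
      have h2 := sum_sq_diff_mono f (Nat.succ_le_of_lt h)
      have h3 := sum_support_le_card d f (Nat.succ_le_of_lt i.2) fun a => hd _
      rw [if_pos hi] at h1
      have h4 := sq_nonneg (f (n + 2) - 2 * f (n + 3))
      simp only [Nat.succ_eq_add_one] at h2 h3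
      change _ < _ + 2 * ((Finset.univ.filter fun a : Fin (n + 3) => d a ≠ 0).card : ℤ)
      linarith
    · have hi' : i.val = n + 2 := by omega
      have h1 := abs_le_sum_sq_diff f h0 (n + 2)
      have h2 := Int.abs_le_sq_self (f (n + 2) - 2 * f (n + 3))
      have h3 := le_abs_self (f (n + 2))
      have h4 := neg_abs_le (f (n + 2) - 2 * f (n + 3))
      rw [hi']
      lia

lemma supportBound_D (n : ℕ) : (D n).gram.SupportBound := by
  refine .of_int fun (d : Fin (n + 4) → ℤ) => ?_
  obtain ⟨f, h0, hd⟩ := exists_shifted_extension d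
  refine ⟨∑ j ∈ Finset.range (n + 2), (f (j + 1) - f j) ^ 2 +
    (f (n + 2) - f (n + 3) - f (n + 4)) ^ 2 + (f (n + 3) - f (n + 4)) ^ 2, ?_, by positivity, ?_⟩
  · have cross := sum_mul_ite_last (fun j => (f j : ℝ)) (by simp [h0]) (-f (n + 4)) (n + 2)
    have key := path_form_eq (fun j => (f j : ℝ)) (by simp [h0]) (n + 3)
    change ∑ a : Fin (n + 3 + 1), ∑ b : Fin (n + 3 + 1), (d a : ℝ) * d b * (D n).gram a b = _
    have inner : ∀ a b : Fin (n + 3), (D n).gram a.castSucc b.castSucc =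
        if a = b then 2 else if a.val + 1 = b.val ∨ b.val + 1 = a.val then -1 else 0 := by
      intro a b
      have := a.2.ne
      have := b.2.ne
      have : a.val ≤ n + 2 := by omega
      have : b.val ≤ n + 2 := by omega
      simp [gram_D_apply, Fin.ext_iff, *]
    have right : ∀ a : Fin (n + 3), (D n).gram a.castSucc (Fin.last (n + 3)) =
        if a.val + 1 = n + 2 then -1 else 0 := by
      intro a
      have := a.2.ne
      have h' : ¬ (n + 3 + 1 = a.val) := by omega
      simp [gram_D_apply, Fin.ext_iff, this, h']
    have left : ∀ a : Fin (n + 3), (D n).gram (Fin.last (n + 3)) a.castSucc =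
        if a.val + 1 = n + 2 then -1 else 0 := by
      intro a
      have := a.2.ne'
      have h' : ¬ (n + 3 + 1 = a.val) := by omega
      simp [gram_D_apply, Fin.ext_iff, this, h']
    have corner : (D n).gram (Fin.last (n + 3)) (Fin.last (n + 3)) = 2 := by simp [gram_D_apply]
    have cross_right : ∑ a : Fin (n + 3), (f (a + 1) : ℝ) * f (n + 4) *
        (if a.val + 1 = n + 2 then -1 else 0) = f (n + 2) * -f (n + 4) := by
      rw [← cross, Fin.sum_univ_castSucc]
      simp
    have cross_left : ∑ a : Fin (n + 3), (f (n + 4) : ℝ) * f (a + 1) *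
        (if a.val + 1 = n + 2 then -1 else 0) = f (n + 2) * -f (n + 4) := by
      rw [← cross_right]
      exact Finset.sum_congr rfl fun a _ => by ring
    rw [Fin.sum_univ_castSucc]
    simp only [Fin.sum_univ_castSucc (n := n + 3), Finset.sum_add_distrib, inner, right, left,
      corner, hd, Fin.val_castSucc, Fin.val_last]
    rw [key, cross_right, cross_left, Finset.sum_range_succ]
    push_cast
    ring
  · rintro hr (i : Fin (n + 4)) hi
    rw [hd] at hi ⊢
    obtain h | h := Nat.lt_or_ge i (n + 2)
    · have h1 := two_mul_add_le_sum_sq_diff_add_support f h0 (i + 1)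
      have h2 := sum_sq_diff_mono f (Nat.succ_le_of_lt h)
      have h3 := sum_support_le_card d f (Nat.succ_le_of_lt i.2) fun a => hd _
      rw [if_pos hi] at h1
      have h4 := sq_nonneg (f (n + 2) - f (n + 3) - f (n + 4))
      have h5 := sq_nonneg (f (n + 3) - f (n + 4))
      simp only [Nat.succ_eq_add_one] at h2 h3
      change _ < _ + 2 * ((Finset.univ.filter fun a : Fin (n + 4) => d a ≠ 0).card : ℤ)
      linarith
    · have h1 := abs_le_sum_sq_diff f h0 (n + 2)
      have h2 := Int.abs_le_sq_self (f (n + 2) - f (n + 3) - f (n + 4))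
      have h3 := le_abs_self (f (n + 2))
      have h4 := neg_abs_le (f (n + 2) - f (n + 3) - f (n + 4))
      have h5 := Int.abs_le_sq_self (f (n + 3) - f (n + 4))
      have h6 := neg_abs_le (f (n + 3) - f (n + 4))
      have h7 := le_abs_self (f (n + 3) - f (n + 4))
      obtain hi' | hi' : i.val = n + 2 ∨ i.val = n + 3 := by omega
      all_goals rw [hi']; lia

lemma supportBound_E7 : E7.gram.SupportBound := by
  refine .of_int fun (d : Fin 7 → ℤ) => ?_
  obtain ⟨h0, h⟩ := e7_bound (d 0) (d 1) (d 2) (d 3) (d 4) (d 5) (d 6)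
    ((Finset.univ.filter fun a : Fin 7 => d a ≠ 0).card : ℤ)
    (by rw [Finset.card_filter, Fin.sum_univ_seven]; push_cast; rfl) _ rfl
  refine ⟨_, ?_, mul_nonneg zero_le_two h0, fun hr (i : Fin 7) _ => ?_⟩
  · change ∑ a : Fin 7, ∑ b : Fin 7, (d a : ℝ) * d b * (if a = b then 2
      else if (a.val, b.val) ∈ [(0, 2), (2, 3), (3, 4), (4, 5), (5, 6), (1, 3)] ∨
          (b.val, a.val) ∈ [(0, 2), (2, 3), (3, 4), (4, 5), (5, 6), (1, 3)] then -1
      else 0) = _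
    simp [Fin.sum_univ_seven]
    ring
  · obtain ⟨h₀, h₁, h₂, h₃, h₄, h₅, h₆⟩ := h (by exact_mod_cast hr)
    rw [← mul_add, mul_lt_mul_iff_right₀ two_pos]
    fin_cases i <;> assumption

lemma supportBound_E6 : E6.gram.SupportBound := by
  refine .of_int fun (d : Fin 6 → ℤ) => ?_
  obtain ⟨h0, h⟩ := e7_bound (d 0) (d 1) (d 2) (d 3) (d 4) (d 5) 0
    ((Finset.univ.filter fun a : Fin 6 => d a ≠ 0).card : ℤ)
    (by rw [Finset.card_filter, Fin.sum_univ_six]; push_cast; simp) _ rfl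
  refine ⟨_, ?_, mul_nonneg zero_le_two h0, fun hr (i : Fin 6) _ => ?_⟩
  · change ∑ a : Fin 6, ∑ b : Fin 6, (d a : ℝ) * d b * (if a = b then 2
      else if (a.val, b.val) ∈ [(0, 2), (2, 3), (3, 4), (4, 5), (1, 3)] ∨
          (b.val, a.val) ∈ [(0, 2), (2, 3), (3, 4), (4, 5), (1, 3)] then -1
      else 0) = _
    simp [Fin.sum_univ_six]
    ring
  · obtain ⟨h₀, h₁, h₂, h₃, h₄, h₅, -⟩ := h (by exact_mod_cast hr)
    rw [← mul_add, mul_lt_mul_iff_right₀ two_pos]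
    fin_cases i <;> assumption

lemma supportBound_F4 : F4.gram.SupportBound := by
  refine .of_int fun (d : Fin 4 → ℤ) => ?_
  obtain ⟨h0, h⟩ := f4_bound (d 0) (d 1) (d 2) (d 3)
    ((Finset.univ.filter fun a : Fin 4 => d a ≠ 0).card : ℤ)
    (by rw [Finset.card_filter, Fin.sum_univ_four]; push_cast; rfl) _ rfl
  refine ⟨_, ?_, mul_nonneg zero_le_two h0, fun hr (i : Fin 4) _ => ?_⟩
  · change ∑ a : Fin 4, ∑ b : Fin 4, (d a : ℝ) * d b *
      (!![4, -2, 0, 0; -2, 4, -2, 0; 0, -2, 2, -1; 0, 0, -1, 2] : Matrix _ _ ℝ) a b = _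
    simp [Fin.sum_univ_four]
    ring
  · obtain ⟨h₀, h₁, h₂, h₃⟩ := h (by exact_mod_cast hr)
    rw [← mul_add, mul_lt_mul_iff_right₀ two_pos]
    fin_cases i <;> assumption

lemma supportBound_G2 : G2.gram.SupportBound := by
  refine .of_int fun (d : Fin 2 → ℤ) => ?_
  obtain ⟨h0, h⟩ := g2_bound (d 0) (d 1)
    ((Finset.univ.filter fun a : Fin 2 => d a ≠ 0).card : ℤ)
    (by rw [Finset.card_filter, Fin.sum_univ_two]; push_cast; rfl) _ rfl
  refine ⟨_, ?_, mul_nonneg zero_le_two h0, fun hr (i : Fin 2) _ => ?_⟩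
  · change ∑ a : Fin 2, ∑ b : Fin 2, (d a : ℝ) * d b * (!![2, -3; -3, 6] : Matrix _ _ ℝ) a b = _
    simp [Fin.sum_univ_two]
    ring
  · obtain ⟨h₀, h₁⟩ := h (by exact_mod_cast hr)
    rw [← mul_add, mul_lt_mul_iff_right₀ two_pos]
    fin_cases i <;> assumption

lemma supportBound_gram : ∀ t : NonE8Type, t.gram.SupportBound
  | A n => supportBound_A n
  | B n => supportBound_B n
  | C n => supportBound_C n
  | D n => supportBound_D n
  | E6 => supportBound_E6
  | E7 => supportBound_E7
  | F4 => supportBound_F4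
  | G2 => supportBound_G2

end NonE8Type

lemma sum_sum_mul_blockDiagonal' {ι : Type*} [Fintype ι] [DecidableEq ι] {m : ι → Type*}
    [∀ i, Fintype (m i)] (M : ∀ i, Matrix (m i) (m i) ℝ) (x : (Σ i, m i) → ℝ) :
    ∑ a, ∑ b, x a * x b * Matrix.blockDiagonal' M a b =
      ∑ i, ∑ a, ∑ b, x ⟨i, a⟩ * x ⟨i, b⟩ * M i a b := by
  rw [Fintype.sum_sigma]
  refine Finset.sum_congr rfl fun i _ => Finset.sum_congr rfl fun a _ => ?_
  rw [Fintype.sum_sigma, Finset.sum_eq_single i]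
  · simp
  · intro j _ hj
    simp [Matrix.blockDiagonal'_apply_ne _ _ _ hj.symm]
  · simp

lemma card_filter_sigma {ι : Type*} [Fintype ι] {m : ι → Type*} [∀ i, Fintype (m i)]
    (p : (Σ i, m i) → Prop) [DecidablePred p] :
    (Finset.univ.filter p).card = ∑ i, (Finset.univ.filter fun a => p ⟨i, a⟩).card := by
  simp only [Finset.card_filter, Fintype.sum_sigma]

/-- **Appendix A Lemma.**  Let `d = Σ_j d_j α_j` be an element of the root lattice of a
finite root system with no factors of type `E₈` (given as a finite list of irreducible
non-`E₈` components, with `(·,·)` the invariant form normalized so short roots have squared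
length `2`), and let `r(d) = #{j : d_j ≠ 0}`.  Then for every simple root index `i₀`,
`(d,d)/2 + r(d) ≥ d_{i₀}`, with equality iff `d = 0`. -/
theorem appendixA_inequality
    (L : List NonE8Type)
    (d : ((i : Fin L.length) × Fin (L.get i).rank) → ℤ)
    (i₀ : (i : Fin L.length) × Fin (L.get i).rank) :
    (d i₀ : ℝ) ≤
        (∑ a, ∑ b, (d a : ℝ) * (d b : ℝ) *
            Matrix.blockDiagonal' (fun i => (L.get i).gram) a b) / 2 +
          ((Finset.univ.filter fun a => d a ≠ 0).card : ℝ) ∧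
      (((d i₀ : ℝ) =
          (∑ a, ∑ b, (d a : ℝ) * (d b : ℝ) *
              Matrix.blockDiagonal' (fun i => (L.get i).gram) a b) / 2 +
            ((Finset.univ.filter fun a => d a ≠ 0).card : ℝ)) ↔ d = 0) := by
  have hsum := sum_sum_mul_blockDiagonal' (fun i => (L.get i).gram) fun a => (d a : ℝ)
  have bound := fun i => (L.get i).supportBound_gram fun a => d ⟨i, a⟩
  have hcard := card_filter_sigma fun a => d a ≠ 0
  set q : Fin L.length → ℝ := fun i => ∑ a, ∑ b, (d ⟨i, a⟩ : ℝ) * d ⟨i, b⟩ * (L.get i).gram a b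
  set r : Fin L.length → ℕ := fun i => (Finset.univ.filter fun a => d ⟨i, a⟩ ≠ 0).card
  have hq : ∀ i, 0 ≤ q i := fun i => (bound i).1
  rw [hsum]
  by_cases hi : d i₀ = 0
  · have hpos : 0 ≤ ∑ i, q i := Finset.sum_nonneg fun i _ => hq i
    rw [hi, Int.cast_zero]
    refine ⟨by positivity, fun h => ?_, fun h => ?_⟩
    · have hc : ((Finset.univ.filter fun a => d a ≠ 0).card : ℝ) ≤ 0 := by linarith
      have hc' : (Finset.univ.filter fun a => d a ≠ 0).card = 0 := by
        exact_mod_cast le_antisymm hc (Nat.cast_nonneg _)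
      simpa [Finset.filter_eq_empty_iff, funext_iff] using hc'
    · simp [q, h]
  · have hlt : (d i₀ : ℝ) < q i₀.1 / 2 + r i₀.1 := (bound i₀.1).2 i₀.2 hi
    have hq_le : q i₀.1 ≤ ∑ i, q i :=
      Finset.single_le_sum (fun i _ => hq i) (Finset.mem_univ i₀.1)
    have hr_le : r i₀.1 ≤ (Finset.univ.filter fun a => d a ≠ 0).card := by
      rw [hcard]
      exact Finset.single_le_sum (fun i _ => Nat.zero_le (r i)) (Finset.mem_univ i₀.1)
    have hr_le' : (r i₀.1 : ℝ) ≤ (Finset.univ.filter fun a => d a ≠ 0).card := by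
      exact_mod_cast hr_le
    have hlt' := hlt.trans_le (add_le_add (div_le_div_of_nonneg_right hq_le zero_le_two) hr_le')
    exact ⟨hlt'.le, fun h => absurd h hlt'.ne, fun h => absurd (congrFun h i₀) hi⟩
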